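/- arXiv:1305.0257 — 2 statements merged into one kernel-verified Lean document; each statement's English description precedes it below -/
import Mathlib

section
/- If S ⊆ ℂ^m ⊗ ℂ^n is a subspace such that every density matrix with range in S has non-positive partial transpose, then dim S ≤ (m−1)(n−1). -/
open Matrix Complex Finset
open scoped ComplexOrder

def ptranspose {m n : ℕ} (ρ : Matrix (Fin m × Fin n) (Fin m × Fin n) ℂ) :
    Matrix (Fin m × Fin n) (Fin m × Fin n) ℂ :=
  fun a b => ρ (a.1, b.2) (b.1, a.2)

open MvPolynomial in
/-- The Segre parametrization. -/
noncomputable def segre (m n : ℕ) :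
    MvPolynomial (Fin m × Fin n) ℂ →ₐ[ℂ] MvPolynomial (Fin m ⊕ Fin n) ℂ :=
  aeval fun p => X (Sum.inl p.1) * X (Sum.inr p.2)

/-- Variables killed at step `s`. -/
def killed (m n s : ℕ) : Fin m ⊕ Fin n → Prop
  | Sum.inl i => i.1 < s ∧ i.1 < m - 1
  | Sum.inr j => m - 1 + j.1 < s

open MvPolynomial in
open scoped Classical in
/-- Set the killed variables to zero. -/
noncomputable def killHom (m n s : ℕ) :
    MvPolynomial (Fin m ⊕ Fin n) ℂ →ₐ[ℂ] MvPolynomial (Fin m ⊕ Fin n) ℂ :=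
  aeval fun z => if killed m n s z then 0 else X z

/-- The primes of the chain. -/
noncomputable def chainP (m n s : ℕ) : Ideal (segre m n).range :=
  RingHom.ker (((killHom m n s).comp (segre m n).range.val).toRingHom)

instance (m n s : ℕ) : (chainP m n s).IsPrime := RingHom.ker_isPrime _

lemma mem_chainP {m n s : ℕ} (r : (segre m n).range) :
    r ∈ chainP m n s ↔ killHom m n s r.1 = 0 := Iff.rfl

lemma killed_mono {m n s t : ℕ} (h : s ≤ t) (z) (hz : killed m n s z) : killed m n t z := by
  cases z <;> simp only [killed] at * <;> omega

lemma killHom_comp {m n s t : ℕ} (h : s ≤ t) :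
    (killHom m n t).comp (killHom m n s) = killHom m n t := by
  apply MvPolynomial.algHom_ext
  intro z
  by_cases hz : killed m n s z
  · simp [killHom, hz, killed_mono h z hz]
  · simp [killHom, hz]

lemma chainP_mono {m n s t : ℕ} (h : s ≤ t) : chainP m n s ≤ chainP m n t := by
  intro r hr
  rw [mem_chainP] at *
  rw [← killHom_comp h, AlgHom.comp_apply, hr, map_zero]

/-- The generators. -/
noncomputable def gen {m n : ℕ} (p : Fin m × Fin n) : (segre m n).range :=
  (segre m n).rangeRestrict (MvPolynomial.X p)

lemma gen_mem {m n s : ℕ} (p : Fin m × Fin n) :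
    gen p ∈ chainP m n s ↔ killed m n s (Sum.inl p.1) ∨ killed m n s (Sum.inr p.2) := by
  rw [mem_chainP]
  change killHom m n s (segre m n (MvPolynomial.X p)) = 0 ↔ _
  simp only [segre, killHom, MvPolynomial.aeval_X, map_mul, mul_eq_zero]
  split_ifs <;> simp [*]

lemma chainP_lt {m n s : ℕ} (hm : 0 < m) (hn : 0 < n) (h : s < m + n - 1) :
    chainP m n s < chainP m n (s + 1) := by
  refine lt_of_le_of_ne (chainP_mono (Nat.le_succ s)) fun he => ?_
  by_cases hs : s < m - 1
  · have := gen_mem (s := s) ((⟨s, by omega⟩, ⟨n - 1, by omega⟩) : Fin m × Fin n)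
    rw [he, gen_mem] at this
    simp only [killed] at this
    omega
  · have := gen_mem (s := s) ((⟨m - 1, by omega⟩, ⟨s - (m - 1), by omega⟩) : Fin m × Fin n)
    rw [he, gen_mem] at this
    simp only [killed] at this
    omega

lemma le_height_chainP {m n : ℕ} (hm : 0 < m) (hn : 0 < n) (s : ℕ) (h : s ≤ m + n - 1) :
    (s : ℕ∞) ≤ (chainP m n s).height := by
  induction s with
  | zero => simp
  | succ s ih =>
    have h1 := Ideal.height_add_one_le_of_lt_of_isPrime (chainP_lt hm hn (s := s) (by omega))
    refine le_trans ?_ h1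
    push_cast
    gcongr
    exact ih (by omega)

instance finType (m n : ℕ) : Algebra.FiniteType ℂ (segre m n).range :=
  Algebra.FiniteType.of_surjective (segre m n).rangeRestrict (segre m n).rangeRestrict_surjective

/-- An algebra hom vanishing on generators has kernel the last prime. -/
lemma ker_eq {m n : ℕ} (φ : (segre m n).range →ₐ[ℂ] ℂ) (h : ∀ p, φ (gen p) = 0) :
    RingHom.ker φ = chainP m n (m + n - 1) := by
  ext r
  obtain ⟨q, rfl⟩ := (segre m n).rangeRestrict_surjective r
  have h1 : φ.comp (segre m n).rangeRestrict = MvPolynomial.aeval (fun _ => (0 : ℂ)) := by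
    apply MvPolynomial.algHom_ext
    intro p
    simpa [gen] using h p
  have h2 : (killHom m n (m + n - 1)).comp (segre m n) =
      (Algebra.ofId ℂ _).comp (MvPolynomial.aeval (fun _ => (0 : ℂ))) := by
    apply MvPolynomial.algHom_ext
    intro p
    have := (gen_mem (s := m + n - 1) p).2 (Or.inr (by
      have := p.1.2
      have := p.2.2
      simp only [killed]; omega))
    rw [mem_chainP] at this
    simpa [gen] using this
  have e1 := DFunLike.congr_fun h1 q
  have e2 := DFunLike.congr_fun h2 q
  rw [AlgHom.comp_apply] at e1 e2
  rw [mem_chainP, RingHom.mem_ker]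
  change _ ↔ killHom m n (m + n - 1) (segre m n q) = 0
  rw [e1, e2, AlgHom.comp_apply]
  exact (map_eq_zero_iff _ (MvPolynomial.C_injective _ _)).symm

lemma exists_hom {m n : ℕ} (N : Ideal (segre m n).range) (hN : N.IsMaximal) :
    ∃ φ : (segre m n).range →ₐ[ℂ] ℂ, RingHom.ker φ = N := by
  letI := Ideal.Quotient.field N
  have : Algebra.FiniteType ℂ ((segre m n).range ⧸ N) :=
    Algebra.FiniteType.of_surjective (Ideal.Quotient.mkₐ ℂ N) (Ideal.Quotient.mkₐ_surjective ℂ N)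
  have : Module.Finite ℂ ((segre m n).range ⧸ N) := finite_of_finite_type_of_isJacobsonRing _ _
  have : Algebra.IsIntegral ℂ ((segre m n).range ⧸ N) := Algebra.IsIntegral.of_finite _ _
  let e : ℂ ≃ₐ[ℂ] ((segre m n).range ⧸ N) := AlgEquiv.ofBijective (Algebra.ofId _ _)
    (IsAlgClosed.algebraMap_bijective_of_isIntegral (k := ℂ))
  refine ⟨e.symm.toAlgHom.comp (Ideal.Quotient.mkₐ ℂ N), ?_⟩
  ext r
  rw [RingHom.mem_ker]
  change e.symm (Ideal.Quotient.mk N r) = 0 ↔ _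
  rw [EmbeddingLike.map_eq_zero_iff, Ideal.Quotient.eq_zero_iff_mem]

lemma gen_rel {m n : ℕ} (i k : Fin m) (j l : Fin n) :
    gen (i, j) * gen (k, l) = gen (i, l) * gen (k, j) := by
  apply Subtype.ext
  change segre m n (MvPolynomial.X _) * segre m n (MvPolynomial.X _) =
    segre m n (MvPolynomial.X _) * segre m n (MvPolynomial.X _)
  simp only [segre, MvPolynomial.aeval_X]
  ring

/-- A large subspace contains a nonzero rank one matrix. -/
lemma exists_rank_one {m n : ℕ} (hm : 0 < m) (hn : 0 < n)
    (S : Submodule ℂ (Fin m × Fin n → ℂ))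
    (hS : (m - 1) * (n - 1) < Module.finrank ℂ S) :
    ∃ a ∈ S, a ≠ 0 ∧ ∀ i k j l, a (i, j) * a (k, l) = a (i, l) * a (k, j) := by
  by_contra! hcon
  let Q := (Fin m × Fin n → ℂ) ⧸ S
  let b := Module.finBasis ℂ Q
  have hdim : Module.finrank ℂ Q + Module.finrank ℂ S = m * n := by
    rw [Submodule.finrank_quotient_add_finrank]; simp
  let f : Fin (Module.finrank ℂ Q) → (segre m n).range := fun t =>
    ∑ p, (b.repr (S.mkQ (Pi.single p 1)) t) • gen p
  have key : ∀ N : Ideal (segre m n).range, N.IsMaximal → Ideal.span (Set.range f) ≤ N →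
      N = chainP m n (m + n - 1) := by
    intro N hN hle
    obtain ⟨φ, hφ⟩ := exists_hom N hN
    rw [← hφ]
    apply ker_eq
    let a : Fin m × Fin n → ℂ := fun p => φ (gen p)
    have ha : a ∈ S := by
      rw [← Submodule.Quotient.mk_eq_zero, ← Submodule.mkQ_apply]
      apply b.repr.injective
      ext t
      have h1 : f t ∈ N := hle (Ideal.subset_span ⟨t, rfl⟩)
      rw [← hφ, RingHom.mem_ker] at h1
      simp only [f, map_sum, map_smul, smul_eq_mul] at h1
      have h2 : a = ∑ p, a p • (Pi.single p 1 : Fin m × Fin n → ℂ) := by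
        ext p
        simp [Finset.sum_apply, Pi.single_apply]
      rw [h2]
      simp only [map_sum, map_smul, Finsupp.coe_finsetSum, Finset.sum_apply, Finsupp.smul_apply,
        smul_eq_mul, map_zero, Finsupp.coe_zero, Pi.zero_apply]
      rw [← h1]
      exact Finset.sum_congr rfl fun p _ => mul_comm _ _
    by_contra hne
    have hne' : a ≠ 0 := fun h0 => hne fun p => congr_fun h0 p
    obtain ⟨i, k, j, l, hh⟩ := hcon a ha hne'
    apply hh
    simp only [a, ← map_mul, gen_rel]
  have hmin : chainP m n (m + n - 1) ∈ (Ideal.span (Set.range f)).minimalPrimes := by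
    refine ⟨⟨inferInstance, ?_⟩, ?_⟩
    · rw [Ideal.span_le]
      rintro _ ⟨t, rfl⟩
      refine Ideal.sum_mem _ fun p _ => Submodule.smul_of_tower_mem _ _ ?_
      refine (gen_mem p).2 (Or.inr ?_)
      have := p.2.2
      simp only [killed]; omega
    · rintro P ⟨hP, hIP⟩ hPM
      have hJ : IsJacobsonRing (segre m n).range := isJacobsonRing_of_finiteType (A := ℂ)
      rw [← isJacobsonRing_iff_prime_eq.1 hJ P hP]
      refine le_sInf ?_
      rintro N ⟨hPN, hN⟩
      exact (key N hN (hIP.trans hPN)).ge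
  have : IsNoetherianRing (segre m n).range := Algebra.FiniteType.isNoetherianRing ℂ _
  have h1 := Ideal.height_le_card_of_mem_minimalPrimes_span (Set.finite_range f) hmin
  have h2 := le_height_chainP hm hn (m + n - 1) le_rfl
  have h3 : (Set.range f).ncard ≤ Module.finrank ℂ Q := by
    rw [← Nat.card_coe_set_eq]
    simpa using Finite.card_range_le f
  have h4 : m + n - 1 ≤ Module.finrank ℂ Q := by
    have := h2.trans h1
    exact (by exact_mod_cast this : m + n - 1 ≤ (Set.range f).ncard).trans h3
  obtain ⟨m, rfl⟩ : ∃ m', m = m' + 1 := ⟨m - 1, by omega⟩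
  obtain ⟨n, rfl⟩ : ∃ n', n = n' + 1 := ⟨n - 1, by omega⟩
  simp only [Nat.add_sub_cancel] at hS
  have : (m + 1) * (n + 1) = m * n + m + n + 1 := by ring
  omega

theorem stmt_11 (m n : ℕ) (S : Submodule ℂ (Fin m × Fin n → ℂ))
    (h : ∀ ρ : Matrix (Fin m × Fin n) (Fin m × Fin n) ℂ,
      ρ.PosSemidef → ρ.trace = 1 → (∀ v, ρ *ᵥ v ∈ S) →
      ¬ (ptranspose ρ).PosSemidef) :
    Module.finrank ℂ S ≤ (m - 1) * (n - 1) := by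
  by_contra! hlt
  have hle : Module.finrank ℂ S ≤ m * n := by
    simpa using Submodule.finrank_le S
  have hpos : 0 < m * n := by omega
  obtain ⟨a, haS, ha0, hrel⟩ := exists_rank_one (Nat.pos_of_mul_pos_right hpos)
    (Nat.pos_of_mul_pos_left hpos) S hlt
  obtain ⟨⟨p, q⟩, hpq⟩ : ∃ x, a x ≠ 0 := by
    by_contra! h0
    exact ha0 (funext h0)
  let s : ℂ := a ⬝ᵥ star a
  have hs0 : 0 ≤ s := dotProduct_self_star_nonneg a
  have hs : s ≠ 0 := fun h0 => ha0 (dotProduct_self_star_eq_zero.1 h0)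
  have hsi : 0 ≤ s⁻¹ := inv_nonneg.2 hs0
  let t : Fin m × Fin n → ℂ := fun x => a (x.1, q) * star (a (p, x.2) / a (p, q))
  have hfac : ∀ i j, a (i, j) = a (i, q) * (a (p, j) / a (p, q)) := by
    intro i j
    have := hrel i p j q
    field_simp
    exact this
  refine h (s⁻¹ • vecMulVec a (star a)) ((posSemidef_vecMulVec_self_star a).smul hsi) ?_ ?_ ?_
  · rw [trace_smul, trace_vecMulVec, smul_eq_mul]
    exact inv_mul_cancel₀ hs
  · intro v
    rw [smul_mulVec, vecMulVec_mulVec]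
    exact S.smul_mem _ (by simpa using S.smul_mem (star a ⬝ᵥ v) haS)
  · have : ptranspose (s⁻¹ • vecMulVec a (star a)) = s⁻¹ • vecMulVec t (star t) := by
      ext ⟨i, j⟩ ⟨k, l⟩
      simp only [ptranspose, Matrix.smul_apply, vecMulVec_apply, Pi.star_apply, t]
      rw [hfac i l, hfac k j]
      simp only [star_mul', star_star]
      congr 1
      ring
    rw [this]
    exact (posSemidef_vecMulVec_self_star t).smul hsi
end

section
/- For every density matrix ρ ∈ M_m(ℂ) ⊗ M_n(ℂ), the partial transpose ρ^Γ has at most (m−1)(n−1) negative eigenvalues (counted with multiplicity). -/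
open Matrix Complex Finset
open scoped ComplexOrder

/-- Which variables of `ℂ[x, y]` survive at step `j` of the chain of primes. -/
def segAlive (m n j : ℕ) : Fin (m + 1) ⊕ Fin (n + 1) → Prop
  | Sum.inl i => j ≤ i.val ∨ i.val = m
  | Sum.inr i => j ≤ m + i.val

open Classical in
noncomputable def segVar (m n j : ℕ) (s : Fin (m + 1) ⊕ Fin (n + 1)) :
    MvPolynomial (Fin (m + 1) ⊕ Fin (n + 1)) ℂ :=
  if segAlive m n j s then MvPolynomial.X s else 0

noncomputable def segMap (m n j : ℕ) :
    MvPolynomial (Fin (m + 1) × Fin (n + 1)) ℂ →ₐ[ℂ]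
      MvPolynomial (Fin (m + 1) ⊕ Fin (n + 1)) ℂ :=
  MvPolynomial.aeval fun p => segVar m n j (Sum.inl p.1) * segVar m n j (Sum.inr p.2)

theorem segAlive_mono (m n j : ℕ) (s) (h : segAlive m n (j + 1) s) : segAlive m n j s := by
  rcases s with i | i <;> simp only [segAlive] at * <;> omega

theorem segMap_succ (m n j : ℕ) :
    segMap m n (j + 1) = (MvPolynomial.aeval (segVar m n (j + 1))).comp (segMap m n j) := by
  have key : ∀ s, MvPolynomial.aeval (segVar m n (j + 1)) (segVar m n j s)
      = segVar m n (j + 1) s := by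
    intro s
    by_cases h : segAlive m n j s
    · simp [segVar, h]
    · have : ¬ segAlive m n (j + 1) s := fun h' => h (segAlive_mono m n j s h')
      simp [segVar, h, this]
  apply MvPolynomial.algHom_ext
  intro p
  have hk1 := key (Sum.inl p.1)
  have hk2 := key (Sum.inr p.2)
  rw [AlgHom.comp_apply, segMap, segMap, MvPolynomial.aeval_X, MvPolynomial.aeval_X, map_mul,
    hk1, hk2]

theorem segMap_ker_le (m n j : ℕ) (p) (h : segMap m n 0 p = 0) : segMap m n j p = 0 := by
  induction j with
  | zero => exact h
  | succ j ih => rw [segMap_succ]; simp [ih]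

theorem segMap_eval_zero (m n j : ℕ) (p) (h : segMap m n j p = 0) :
    MvPolynomial.aeval (fun _ => (0 : ℂ)) p = 0 := by
  have : (MvPolynomial.aeval (fun _ => (0 : ℂ))).comp (segMap m n j)
      = MvPolynomial.aeval (fun _ => (0 : ℂ)) := by
    apply MvPolynomial.algHom_ext
    intro q
    simp only [segMap, segVar]
    simp
    split_ifs <;> simp
  rw [← this]
  simp [h]

theorem segMap_last (m n : ℕ) (q) : segMap m n (m + n + 1) (MvPolynomial.X q) = 0 := by
  have : ¬ segAlive m n (m + n + 1) (Sum.inr q.2) := by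
    have := q.2.isLt
    simp only [segAlive]; omega
  simp [segMap, segVar, this]

theorem segMap_strict (m n j : ℕ) (hj : j ≤ m + n) :
    ∃ q, segMap m n j (MvPolynomial.X q) ≠ 0 ∧ segMap m n (j + 1) (MvPolynomial.X q) = 0 := by
  by_cases h : j < m
  · refine ⟨(⟨j, by omega⟩, ⟨n, by omega⟩), ?_, ?_⟩
    · have h1 : segAlive m n j (Sum.inl ⟨j, by omega⟩) := by simp [segAlive]
      have h2 : segAlive m n j (Sum.inr ⟨n, by omega⟩) := by simp [segAlive]; omega
      simp [segMap, segVar, h1, h2]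
    · have h1 : ¬ segAlive m n (j + 1) (Sum.inl ⟨j, by omega⟩) := by simp [segAlive]; omega
      simp [segMap, segVar, h1]
  · refine ⟨(⟨m, by omega⟩, ⟨j - m, by omega⟩), ?_, ?_⟩
    · have h1 : segAlive m n j (Sum.inl ⟨m, by omega⟩) := by simp [segAlive]
      have h2 : segAlive m n j (Sum.inr ⟨j - m, by omega⟩) := by simp [segAlive]; omega
      simp [segMap, segVar, h1, h2]
    · have h1 : ¬ segAlive m n (j + 1) (Sum.inr ⟨j - m, by omega⟩) := by
        simp [segAlive]; omega
      simp [segMap, segVar, h1]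

abbrev SegRing (m n : ℕ) : Type :=
  MvPolynomial (Fin (m + 1) × Fin (n + 1)) ℂ ⧸ RingHom.ker (segMap m n 0).toRingHom

noncomputable def segLift (m n j : ℕ) :
    SegRing m n →+* MvPolynomial (Fin (m + 1) ⊕ Fin (n + 1)) ℂ :=
  Ideal.Quotient.lift _ (segMap m n j).toRingHom (fun a ha => segMap_ker_le m n j a ha)

theorem segLift_mk (m n j : ℕ) (p) :
    segLift m n j (Ideal.Quotient.mk _ p) = segMap m n j p := rfl

theorem segLift_height (m n j : ℕ) (hj : j ≤ m + n + 1) :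
    (j : ℕ∞) ≤ (RingHom.ker (segLift m n j)).height := by
  induction j with
  | zero => simp
  | succ j ih =>
    have h1 : (RingHom.ker (segLift m n j)).IsPrime := RingHom.ker_isPrime _
    have h2 : (RingHom.ker (segLift m n (j + 1))).IsPrime := RingHom.ker_isPrime _
    have hlt : RingHom.ker (segLift m n j) < RingHom.ker (segLift m n (j + 1)) := by
      refine lt_of_le_not_ge ?_ ?_
      · intro s hs
        obtain ⟨p, rfl⟩ := Ideal.Quotient.mk_surjective s
        rw [RingHom.mem_ker, segLift_mk] at hs ⊢
        rw [segMap_succ]; simp [hs]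
      · intro hle
        obtain ⟨q, hq1, hq2⟩ := segMap_strict m n j (by omega)
        exact hq1 (hle (x := Ideal.Quotient.mk _ (MvPolynomial.X q)) hq2)
    have := Ideal.height_add_one_le_of_lt_of_isPrime hlt
    refine le_trans ?_ this
    push_cast
    gcongr
    exact ih (by omega)

theorem exists_product_zero (m n : ℕ) {ι : Type*} [Fintype ι] (hι : Fintype.card ι ≤ m + n)
    (l : ι → Fin (m + 1) × Fin (n + 1) → ℂ) :
    ∃ (v : Fin (m + 1) → ℂ) (w : Fin (n + 1) → ℂ), (∃ i j, v i * w j ≠ 0) ∧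
      ∀ k, ∑ p, l k p * (v p.1 * w p.2) = 0 := by
  classical
  by_contra hcon
  push Not at hcon
  let L : ι → MvPolynomial (Fin (m + 1) × Fin (n + 1)) ℂ :=
    fun k => ∑ p, MvPolynomial.C (l k p) * MvPolynomial.X p
  let S : Finset (SegRing m n) := Finset.univ.image fun k => Ideal.Quotient.mk _ (L k)
  have hprime : (RingHom.ker (segLift m n (m + n + 1))).IsPrime := RingHom.ker_isPrime _
  have hmin : RingHom.ker (segLift m n (m + n + 1)) ∈ (Ideal.span (S : Set _)).minimalPrimes := by
    refine ⟨⟨hprime, ?_⟩, ?_⟩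
    · rw [Ideal.span_le]
      intro s hs
      simp only [S, Finset.coe_image, Finset.coe_univ, Set.image_univ, Set.mem_range] at hs
      obtain ⟨k, rfl⟩ := hs
      change segMap m n (m + n + 1) (L k) = 0
      simp [L, segMap_last]
    · rintro q ⟨hq, hSq⟩ -
      intro s hs
      obtain ⟨p, rfl⟩ := Ideal.Quotient.mk_surjective s
      have hp0 := segMap_eval_zero m n _ p hs
      set Q := q.comap (Ideal.Quotient.mk (RingHom.ker (segMap m n 0).toRingHom)) with hQ
      have hQp : Q.IsPrime := Ideal.comap_isPrime _ _
      change p ∈ Q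
      rw [← MvPolynomial.IsPrime.vanishingIdeal_zeroLocus (K := ℂ) Q]
      intro z hz
      suffices z = fun _ => 0 by rw [this]; exact hp0
      have hker : ∀ f, segMap m n 0 f = 0 → MvPolynomial.aeval z f = 0 := by
        intro f hf
        apply hz
        change Ideal.Quotient.mk _ f ∈ q
        rw [Ideal.Quotient.eq_zero_iff_mem.mpr hf]
        exact q.zero_mem
      have hminor : ∀ i j i' j', z (i, j) * z (i', j') = z (i, j') * z (i', j) := by
        intro i j i' j'
        have := hker (MvPolynomial.X (i, j) * MvPolynomial.X (i', j')
          - MvPolynomial.X (i, j') * MvPolynomial.X (i', j)) (by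
            simp [segMap]; ring)
        simpa [sub_eq_zero] using this
      have hL : ∀ k, ∑ p, l k p * z p = 0 := by
        intro k
        have := hz (L k) (hSq (Ideal.subset_span (Finset.mem_coe.mpr
          (Finset.mem_image_of_mem _ (Finset.mem_univ k)))))
        simpa [L] using this
      by_contra hne
      obtain ⟨⟨a, b⟩, hab⟩ := Function.ne_iff.mp hne
      obtain ⟨k, hk⟩ := hcon (fun i => z (i, b)) (fun j => z (a, j)) ⟨a, b, mul_ne_zero hab hab⟩
      apply hk
      have : ∀ p : Fin (m + 1) × Fin (n + 1), l k p * (z (p.1, b) * z (a, p.2))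
          = (l k p * z p) * z (a, b) := by
        intro p
        rw [hminor p.1 b a p.2]; ring
      rw [Finset.sum_congr rfl fun p _ => this p, ← Finset.sum_mul, hL k, zero_mul]
  have h1 := Ideal.height_le_card_of_mem_minimalPrimes_span_finset hmin
  have h2 := segLift_height m n (m + n + 1) le_rfl
  have h3 : S.card ≤ m + n := (Finset.card_image_le.trans (by simp)).trans hι
  have h4 : m + n + 1 ≤ S.card := by exact_mod_cast h2.trans h1
  omega

theorem ptranspose_product_nonneg {m n : ℕ} (ρ : Matrix (Fin m × Fin n) (Fin m × Fin n) ℂ)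
    (hρ : ρ.PosSemidef) (v : Fin m → ℂ) (w : Fin n → ℂ) :
    0 ≤ star (fun p : Fin m × Fin n => v p.1 * w p.2) ⬝ᵥ
      (ptranspose ρ *ᵥ fun p => v p.1 * w p.2) := by
  have h := hρ.dotProduct_mulVec_nonneg (fun p : Fin m × Fin n => v p.1 * star (w p.2))
  convert h using 1
  simp only [dotProduct, mulVec, Fintype.sum_prod_type, Finset.mul_sum, ptranspose, Pi.star_apply,
    star_mul', star_star]
  refine Finset.sum_congr rfl fun i _ => ?_
  rw [Finset.sum_comm]
  conv_rhs => rw [Finset.sum_comm]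
  refine Finset.sum_congr rfl fun i' _ => ?_
  rw [Finset.sum_comm]
  refine Finset.sum_congr rfl fun j _ => Finset.sum_congr rfl fun j' _ => ?_
  ring

theorem quad_form_eigen {ι : Type*} [Fintype ι] [DecidableEq ι] (A : Matrix ι ι ℂ)
    (hA : A.IsHermitian) (z : ι → ℂ) :
    star z ⬝ᵥ (A *ᵥ z) = ((∑ k, hA.eigenvalues k *
      Complex.normSq (∑ p, star (hA.eigenvectorBasis k p) * z p) : ℝ) : ℂ) := by
  have hU : ∀ k, (star (hA.eigenvectorUnitary : Matrix ι ι ℂ) *ᵥ z) k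
      = ∑ p, star (hA.eigenvectorBasis k p) * z p := by
    intro k
    simp [mulVec, dotProduct, Matrix.star_apply]
  have hy : star z ᵥ* (hA.eigenvectorUnitary : Matrix ι ι ℂ)
      = star (star (hA.eigenvectorUnitary : Matrix ι ι ℂ) *ᵥ z) := by
    rw [star_mulVec, star_eq_conjTranspose, conjTranspose_conjTranspose]
  conv_lhs => rw [hA.spectral_theorem, Unitary.conjStarAlgAut_apply]
  rw [← mulVec_mulVec, ← mulVec_mulVec, dotProduct_mulVec, hy]
  simp only [dotProduct, mulVec_diagonal, Pi.star_apply, hU]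
  push_cast
  refine Finset.sum_congr rfl fun k _ => ?_
  rw [Complex.normSq_eq_conj_mul_self]
  simp only [Function.comp, starRingEnd_apply]
  simp
  ring

theorem eigen_coord_ne {ι : Type*} [Fintype ι] [DecidableEq ι] (A : Matrix ι ι ℂ)
    (hA : A.IsHermitian) (z : ι → ℂ) (hz : z ≠ 0) :
    ∃ k, ∑ p, star (hA.eigenvectorBasis k p) * z p ≠ 0 := by
  by_contra hcon
  push Not at hcon
  apply hz
  have hU : star (hA.eigenvectorUnitary : Matrix ι ι ℂ) *ᵥ z = 0 := by
    ext k
    rw [Pi.zero_apply, ← hcon k]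
    simp [mulVec, dotProduct, Matrix.star_apply]
  have := congrArg (fun y => (hA.eigenvectorUnitary : Matrix ι ι ℂ) *ᵥ y) hU
  simpa [mulVec_mulVec] using this

theorem stmt_19 (m n : ℕ)
    (ρ : Matrix (Fin m × Fin n) (Fin m × Fin n) ℂ)
    (hρ : ρ.PosSemidef) (htr : ρ.trace = 1)
    (hΓ : (ptranspose ρ).IsHermitian) :
    (Finset.univ.filter fun i => hΓ.eigenvalues i < 0).card
      ≤ (m - 1) * (n - 1) := by
  rcases m with _ | m
  · simp [Finset.univ_eq_empty]
  rcases n with _ | n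
  · simp [Finset.univ_eq_empty]
  simp only [Nat.add_sub_cancel]
  by_contra hlt
  push Not at hlt
  have hsum := Finset.card_filter_add_card_filter_not (s := Finset.univ)
    (fun i => hΓ.eigenvalues i < 0)
  rw [Finset.card_univ, Fintype.card_prod, Fintype.card_fin, Fintype.card_fin] at hsum
  have hcard : Fintype.card {i // ¬ hΓ.eigenvalues i < 0} ≤ m + n := by
    rw [Fintype.card_subtype]
    have : (m + 1) * (n + 1) = m * n + m + n + 1 := by ring
    omega
  obtain ⟨v, w, ⟨a, b, hab⟩, hvw⟩ := exists_product_zero m n hcard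
    (fun k p => star (hΓ.eigenvectorBasis k.1 p))
  set z : Fin (m + 1) × Fin (n + 1) → ℂ := fun p => v p.1 * w p.2 with hzdef
  have hz : z ≠ 0 := fun h => hab (congrFun h (a, b))
  have hnn := ptranspose_product_nonneg ρ hρ v w
  rw [← hzdef, quad_form_eigen _ hΓ z, Complex.zero_le_real] at hnn
  have hvw' : ∀ k, ¬ hΓ.eigenvalues k < 0 →
      ∑ p, star (hΓ.eigenvectorBasis k p) * z p = 0 := fun k hk => hvw ⟨k, hk⟩
  obtain ⟨k, hk⟩ := eigen_coord_ne _ hΓ z hz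
  refine absurd hnn (not_le.mpr ?_)
  refine Finset.sum_neg' (fun i _ => ?_) ⟨k, Finset.mem_univ k, ?_⟩
  · by_cases hi : hΓ.eigenvalues i < 0
    · exact mul_nonpos_of_nonpos_of_nonneg hi.le (Complex.normSq_nonneg _)
    · rw [hvw' i hi]; simp
  · have hneg : hΓ.eigenvalues k < 0 := by
      by_contra h
      exact hk (hvw' k h)
    exact mul_neg_of_neg_of_pos hneg (Complex.normSq_pos.mpr hk)
end
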